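/- Let A be an n×n hidden Z-matrix that is an almost P-matrix (all proper principal minors positive, det A < 0). Then A⁻¹ is an N-matrix of the second category, i.e., all principal minors of A⁻¹ are negative and all entries of A⁻¹ are nonpositive. -/

import Mathlib

open Matrix

/-- A Z-matrix: all off-diagonal entries are nonpositive. -/
def IsZMatrix {ι : Type*} [Fintype ι] [DecidableEq ι] (A : Matrix ι ι ℝ) : Prop :=
  ∀ i j, i ≠ j → A i j ≤ 0

/-- A hidden Z-matrix: AX = Y for Z-matrices X, Y, with rᵀX + sᵀY > 0 for some r, s ≥ 0. -/
def IsHiddenZ {ι : Type*} [Fintype ι] [DecidableEq ι] (A : Matrix ι ι ℝ) : Prop :=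
  ∃ X Y : Matrix ι ι ℝ, ∃ r s : ι → ℝ,
    IsZMatrix X ∧ IsZMatrix Y ∧ A * X = Y ∧
    (∀ i, 0 ≤ r i) ∧ (∀ i, 0 ≤ s i) ∧
    (∀ j, 0 < (Matrix.vecMul r X + Matrix.vecMul s Y) j)

/-- The principal minor of `A` indexed by `α`. -/
def principalMinor {ι : Type*} [Fintype ι] [DecidableEq ι] (A : Matrix ι ι ℝ)
    (α : Finset ι) : ℝ :=
  (A.submatrix (fun i : {x // x ∈ α} => (i : ι)) (fun j : {x // x ∈ α} => (j : ι))).det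

section MixedRows

variable {ι : Type*} [DecidableEq ι]

/-- The matrix whose rows indexed by `α` are taken from `Y` and the others from `X`. -/
def mixedRows (X Y : Matrix ι ι ℝ) (α : Finset ι) : Matrix ι ι ℝ :=
  fun i => if i ∈ α then Y i else X i

lemma update_zero_nonneg {t : ι → ℝ} (ht : ∀ k, 0 ≤ t k) (i k : ι) :
    0 ≤ Function.update t i 0 k := by
  by_cases hk : k = i
  · simp [hk]
  · simpa [hk] using ht k

variable [Fintype ι]

lemma mixedRows_one_mul (A X : Matrix ι ι ℝ) (α : Finset ι) :
    mixedRows 1 A α * X = mixedRows X (A * X) α := by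
  ext i j
  by_cases h : i ∈ α
  · simp [mixedRows, Matrix.mul_apply, h]
  · have h1 := congrFun (congrFun (Matrix.one_mul X) i) j
    simpa [mixedRows, Matrix.mul_apply, h] using h1

lemma det_mixedRows_one (A : Matrix ι ι ℝ) (α : Finset ι) :
    (mixedRows 1 A α).det = principalMinor A α := by
  rw [Matrix.twoBlockTriangular_det _ (fun i => i ∈ α)]
  · have h1 : (mixedRows 1 A α).toSquareBlockProp (fun i => i ∈ α) =
        A.submatrix (fun i : {x // x ∈ α} => (i : ι)) (fun j : {x // x ∈ α} => (j : ι)) := by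
      ext i j
      simp [mixedRows, Matrix.toSquareBlockProp]
    have h2 : (mixedRows 1 A α).toSquareBlockProp (fun i => ¬ i ∈ α) = 1 := by
      ext i j
      simp [mixedRows, Matrix.toSquareBlockProp, i.2, Matrix.one_apply, Subtype.ext_iff]
    rw [h1, h2, Matrix.det_one, mul_one, principalMinor]
    convert rfl
  · intro i hi j hj
    have hij : i ≠ j := fun h => hi (h ▸ hj)
    simp [mixedRows, hi, hij]

/-- Jacobi's identity for complementary principal minors of the inverse. -/
lemma principalMinor_inv_mul_det (A : Matrix ι ι ℝ) (hA : A.det ≠ 0) (β : Finset ι) :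
    principalMinor A⁻¹ β * A.det = principalMinor A βᶜ := by
  rw [← det_mixedRows_one, ← det_mixedRows_one, ← Matrix.det_mul, mixedRows_one_mul,
    Matrix.nonsing_inv_mul A (isUnit_iff_ne_zero.mpr hA)]
  congr 1
  ext i j
  by_cases h : i ∈ β <;> simp [mixedRows, h]

lemma principalMinor_singleton (A : Matrix ι ι ℝ) (i : ι) :
    principalMinor A {i} = A i i := by
  rw [← det_mixedRows_one]
  have h : mixedRows 1 A {i} =
      (1 : Matrix ι ι ℝ).updateRow i (∑ k, A i k • (1 : Matrix ι ι ℝ) k) := by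
    ext k j
    by_cases h : k = i
    · subst h
      simp [mixedRows, Finset.sum_apply, Matrix.one_apply]
    · simp [mixedRows, h, Matrix.updateRow_ne]
  rw [h, Matrix.det_updateRow_sum]
  simp

/-- A Z-matrix with `tᵀ T > 0` for some `t ≥ 0`; these are the nonsingular M-matrices. -/
def IsSemipositiveZ (T : Matrix ι ι ℝ) : Prop :=
  IsZMatrix T ∧ ∃ t : ι → ℝ, (∀ i, 0 ≤ t i) ∧ ∀ j, 0 < (t ᵥ* T) j

/-- Left monotonicity of a Z-matrix, relative to an index set `S`. -/
lemma IsZMatrix.nonneg_of_vecMul {T : Matrix ι ι ℝ} (hT : IsZMatrix T) (S : Finset ι)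
    {t z : ι → ℝ} (ht : ∀ i, 0 ≤ t i) (htS : ∀ j ∈ S, 0 < (t ᵥ* T) j)
    (hz : ∀ j ∉ S, 0 ≤ z j) (hzS : ∀ j ∈ S, 0 ≤ (z ᵥ* T) j) : ∀ j, 0 ≤ z j := by
  have key : ∀ y : ι → ℝ, (∀ i, 0 ≤ y i) → ∀ k, y k = 0 → (y ᵥ* T) k ≤ 0 := by
    intro y hy k hk
    refine Finset.sum_nonpos fun l _ => ?_
    by_cases hl : l = k
    · simp [hl, hk]
    · exact mul_nonpos_of_nonneg_of_nonpos (hy l) (hT l k hl)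
  have htpos : ∀ j ∈ S, 0 < t j := fun j hj =>
    lt_of_le_of_ne (ht j) fun h => (htS j hj).not_ge (key t ht j h.symm)
  by_contra! hneg
  obtain ⟨j, hj⟩ := hneg
  have hjS : j ∈ S := by
    by_contra h
    exact hj.not_ge (hz j h)
  obtain ⟨k, hk, hmin⟩ := S.exists_min_image (fun l => z l / t l) ⟨j, hjS⟩
  have hq : z k / t k < 0 := (hmin j hjS).trans_lt (div_neg_of_neg_of_pos hj (htpos j hjS))
  have hle := key (z + (-(z k / t k)) • t) (fun l => by
    simp only [Pi.add_apply, Pi.smul_apply, smul_eq_mul]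
    by_cases hl : l ∈ S
    · have := (le_div_iff₀ (htpos l hl)).mp (hmin l hl)
      linarith
    · have := hz l hl
      have := mul_nonneg (neg_nonneg.mpr hq.le) (ht l)
      linarith) k (by
    have := (htpos k hk).ne'
    simp only [Pi.add_apply, Pi.smul_apply, smul_eq_mul]
    field_simp
    ring)
  rw [Matrix.add_vecMul, Matrix.smul_vecMul] at hle
  simp only [Pi.add_apply, Pi.smul_apply, smul_eq_mul] at hle
  have := hzS k hk
  have := mul_pos (neg_pos.mpr hq) (htS k hk)
  linarith

lemma IsSemipositiveZ.det_ne_zero {T : Matrix ι ι ℝ} (hT : IsSemipositiveZ T) : T.det ≠ 0 := by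
  obtain ⟨hZ, t, ht, htT⟩ := hT
  intro h
  obtain ⟨v, hv, hvT⟩ := Matrix.exists_vecMul_eq_zero_iff.mpr h
  refine hv (funext fun j => le_antisymm ?_ ?_)
  · have := hZ.nonneg_of_vecMul Finset.univ (z := -v) ht (fun j _ => htT j) (by simp)
      (by simp [Matrix.neg_vecMul, hvT]) j
    simpa using this
  · exact hZ.nonneg_of_vecMul Finset.univ (z := v) ht (fun j _ => htT j) (by simp)
      (by simp [hvT]) j

/-- A certificate for `T` restricts to the indices other than `i`, independently of row `i`. -/
lemma vecMul_update_zero_pos {T T' : Matrix ι ι ℝ} (hT : IsZMatrix T) {i : ι}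
    (h : ∀ k, k ≠ i → T' k = T k) {t : ι → ℝ} (ht : ∀ k, 0 ≤ t k) (htT : ∀ j, 0 < (t ᵥ* T) j)
    {j : ι} (hj : j ≠ i) : 0 < (Function.update t i 0 ᵥ* T') j := by
  refine (htT j).trans_le (Finset.sum_le_sum fun k _ => ?_)
  by_cases hk : k = i
  · subst hk
    simpa using mul_nonpos_of_nonneg_of_nonpos (ht k) (hT k j hj.symm)
  · simp [hk, h k hk]

/-- If two Z-matrices differ in one row and their determinants have the same sign, then one is
semipositive as soon as the other is. -/
lemma IsSemipositiveZ.of_row_ne {T T' : Matrix ι ι ℝ} (hT : IsSemipositiveZ T)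
    (hT' : IsZMatrix T') (i : ι) (h : ∀ k, k ≠ i → T' k = T k) (hdet : 0 < T.det * T'.det) :
    IsSemipositiveZ T' := by
  obtain ⟨hZ, t, ht, htT⟩ := hT
  have hd' : T'.det ≠ 0 := by
    rintro h0
    simp [h0] at hdet
  obtain ⟨t', ht'⟩ : ∃ t', t' ᵥ* T' = t ᵥ* T :=
    ⟨(t ᵥ* T) ᵥ* T'⁻¹, by
      rw [Matrix.vecMul_vecMul, Matrix.nonsing_inv_mul _ (isUnit_iff_ne_zero.mpr hd'),
        Matrix.vecMul_one]⟩
  have hrow : t' i * T'.det = t i * T.det := by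
    have h1 := Matrix.det_updateRow_sum T' i t'
    have h2 := Matrix.det_updateRow_sum T i t
    rw [← Matrix.vecMul_eq_sum] at h1 h2
    have h3 : T'.updateRow i (t' ᵥ* T') = T.updateRow i (t ᵥ* T) := by
      ext k j
      by_cases hk : k = i
      · subst hk
        simp [ht']
      · simp [Matrix.updateRow_ne hk, h k hk]
    rw [h3, h2] at h1
    simpa using h1.symm
  have hi : 0 ≤ t' i := by
    have : 0 ≤ t' i * (T'.det * T'.det) := by
      rw [← mul_assoc, hrow, mul_assoc]
      exact mul_nonneg (ht i) hdet.le
    exact nonneg_of_mul_nonneg_left this (mul_self_pos.mpr hd')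
  refine ⟨hT', t', ?_, fun j => by rw [ht']; exact htT j⟩
  refine hT'.nonneg_of_vecMul (Finset.univ.erase i) (update_zero_nonneg ht i)
    (fun j hj => vecMul_update_zero_pos hZ h ht htT (Finset.ne_of_mem_erase hj)) ?_ ?_
  · intro j hj
    have : j = i := by simpa using hj
    rwa [this]
  · intro j _
    rw [ht']
    exact (htT j).le

lemma IsZMatrix.updateRow {T X : Matrix ι ι ℝ} (hT : IsZMatrix T) (hX : IsZMatrix X) (i : ι) :
    IsZMatrix (T.updateRow i (X i)) := by
  intro k j hkj
  by_cases hk : k = i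
  · subst hk
    simpa using hX k j hkj
  · simpa [Matrix.updateRow_ne hk] using hT k j hkj

lemma IsZMatrix.mixedRows {X Y : Matrix ι ι ℝ} (hX : IsZMatrix X) (hY : IsZMatrix Y)
    (α : Finset ι) : IsZMatrix (mixedRows X Y α) := by
  intro i j hij
  by_cases h : i ∈ α
  · simpa [_root_.mixedRows, h] using hY i j hij
  · simpa [_root_.mixedRows, h] using hX i j hij

lemma exists_isSemipositiveZ_mixedRows {X Y : Matrix ι ι ℝ} (hX : IsZMatrix X)
    (hY : IsZMatrix Y) {r s : ι → ℝ} (hr : ∀ i, 0 ≤ r i) (hs : ∀ i, 0 ≤ s i)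
    (hrs : ∀ j, 0 < (r ᵥ* X + s ᵥ* Y) j) :
    ∃ α : Finset ι, IsSemipositiveZ (mixedRows X Y α) := by
  have main : ∀ S : Finset ι, ∃ T : Matrix ι ι ℝ, IsSemipositiveZ T ∧
      (∀ i ∈ S, T i = X i ∨ T i = Y i) ∧ ∀ i ∉ S, T i = r i • X i + s i • Y i := by
    intro S
    induction S using Finset.induction_on with
    | empty =>
      refine ⟨fun i => r i • X i + s i • Y i, ⟨fun i j hij => ?_, fun _ => 1,
        fun _ => zero_le_one, fun j => ?_⟩, by simp, by simp⟩
      · have h1 := mul_nonpos_of_nonneg_of_nonpos (hr i) (hX i j hij)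
        have h2 := mul_nonpos_of_nonneg_of_nonpos (hs i) (hY i j hij)
        simpa using add_nonpos h1 h2
      · have := hrs j
        simpa [Matrix.vecMul, dotProduct, Finset.sum_add_distrib] using this
    | insert i S hi ih =>
      obtain ⟨T, hT, hTS, hTr⟩ := ih
      have hdet : T.det = r i * (T.updateRow i (X i)).det + s i * (T.updateRow i (Y i)).det := by
        conv_lhs => rw [← Matrix.updateRow_eq_self T i, hTr i hi]
        rw [Matrix.det_updateRow_add, Matrix.det_updateRow_smul, Matrix.det_updateRow_smul]
      have step : ∀ V : Matrix ι ι ℝ, IsZMatrix V → (V i = X i ∨ V i = Y i) →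
          0 < T.det * (T.updateRow i (V i)).det →
          ∃ T : Matrix ι ι ℝ, IsSemipositiveZ T ∧
            (∀ k ∈ insert i S, T k = X k ∨ T k = Y k) ∧
            ∀ k ∉ insert i S, T k = r k • X k + s k • Y k := by
        intro V hV hVi hpos
        have hne : ∀ k, k ≠ i → T.updateRow i (V i) k = T k := fun k hk =>
          Matrix.updateRow_ne hk
        refine ⟨T.updateRow i (V i), hT.of_row_ne (hT.1.updateRow hV i) i hne hpos, ?_, ?_⟩
        · intro k hk
          by_cases hki : k = i
          · subst hki
            simpa using hVi
          · rw [hne k hki]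
            exact hTS k (Finset.mem_of_mem_insert_of_ne hk hki)
        · intro k hk
          rw [Finset.mem_insert, not_or] at hk
          rw [hne k hk.1]
          exact hTr k hk.2
      by_contra hcon
      have h1 := not_lt.mp fun h => hcon (step X hX (Or.inl rfl) h)
      have h2 := not_lt.mp fun h => hcon (step Y hY (Or.inr rfl) h)
      have h3 : T.det * T.det = r i * (T.det * (T.updateRow i (X i)).det) +
          s i * (T.det * (T.updateRow i (Y i)).det) := by
        nth_rewrite 2 [hdet]
        ring
      have h4 := mul_self_pos.mpr hT.det_ne_zero
      have h5 := mul_nonpos_of_nonneg_of_nonpos (hr i) h1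
      have h6 := mul_nonpos_of_nonneg_of_nonpos (hs i) h2
      linarith
  classical
  obtain ⟨T, hT, hTS, -⟩ := main Finset.univ
  refine ⟨Finset.univ.filter fun i => T i = Y i, ?_⟩
  convert hT using 1
  funext i
  by_cases h : T i = Y i
  · simp [mixedRows, h]
  · simpa [mixedRows, h] using ((hTS i (Finset.mem_univ i)).resolve_right h).symm

/-- When all proper principal minors of `A` are positive, semipositivity propagates among the
proper row mixtures of `X` and `A * X`. -/
lemma isSemipositiveZ_mixedRows_iff {A X : Matrix ι ι ℝ} (hX : IsZMatrix X)
    (hY : IsZMatrix (A * X)) (hA : ∀ β : Finset ι, β ≠ Finset.univ → 0 < principalMinor A β)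
    {α : Finset ι} (hα : α ≠ Finset.univ) :
    IsSemipositiveZ (mixedRows X (A * X) α) ↔ IsSemipositiveZ (mixedRows X (A * X) ∅) := by
  have hdet : ∀ β, (mixedRows X (A * X) β).det = principalMinor A β * X.det := fun β => by
    rw [← mixedRows_one_mul, Matrix.det_mul, det_mixedRows_one]
  have step : ∀ β γ k, β ≠ Finset.univ → γ ≠ Finset.univ → (∀ l, l ≠ k → (l ∈ γ ↔ l ∈ β)) →
      IsSemipositiveZ (mixedRows X (A * X) β) → IsSemipositiveZ (mixedRows X (A * X) γ) := by
    intro β γ k hβ hγ hk h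
    refine h.of_row_ne (hX.mixedRows hY γ) k (fun l hl => by simp [mixedRows, hk l hl]) ?_
    have hXd : X.det ≠ 0 := by
      intro h0
      exact h.det_ne_zero (by rw [hdet, h0, mul_zero])
    rw [hdet, hdet, mul_mul_mul_comm]
    exact mul_pos (mul_pos (hA β hβ) (hA γ hγ)) (mul_self_pos.mpr hXd)
  induction α using Finset.induction_on with
  | empty => rfl
  | insert k α _ ih =>
    have hα' : α ≠ Finset.univ := by
      rintro rfl
      simp at hα
    refine Iff.trans ⟨step _ _ k hα hα' ?_, step _ _ k hα' hα ?_⟩ (ih hα') <;>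
      simp +contextual

end MixedRows

theorem hiddenZ_almostP_inv_N2 {n : ℕ} (A : Matrix (Fin n) (Fin n) ℝ)
    (hA : IsHiddenZ A)
    (hproper : ∀ β : Finset (Fin n), β ≠ Finset.univ → 0 < principalMinor A β)
    (hdet : A.det < 0) :
    (∀ β : Finset (Fin n), β.Nonempty → principalMinor A⁻¹ β < 0) ∧
    (∀ i j, A⁻¹ i j ≤ 0) := by
  have hminor : ∀ β : Finset (Fin n), β.Nonempty → principalMinor A⁻¹ β < 0 := by
    intro β hβ
    have hpos := hproper βᶜ (by simpa using hβ.ne_empty)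
    rw [← principalMinor_inv_mul_det A hdet.ne β] at hpos
    exact neg_of_mul_pos_left hpos hdet.le
  refine ⟨hminor, fun i => ?_⟩
  obtain ⟨X, _, r, s, hX, hY, rfl, hr, hs, hrs⟩ := hA
  have hdiag : A⁻¹ i i < 0 := by
    simpa [principalMinor_singleton] using hminor {i} (Finset.singleton_nonempty i)
  obtain ⟨t, ht, htY⟩ : ∃ t : Fin n → ℝ, (∀ k, 0 ≤ t k) ∧
      ∀ j ∈ Finset.univ.erase i, 0 < (t ᵥ* (A * X)) j := by
    obtain ⟨α, hα⟩ := exists_isSemipositiveZ_mixedRows hX hY hr hs hrs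
    by_cases huniv : α = Finset.univ
    · obtain ⟨-, t, ht, htT⟩ := hα
      refine ⟨t, ht, fun j _ => ?_⟩
      have hY' : mixedRows X (A * X) α = A * X := by
        funext k
        simp [mixedRows, huniv]
      rw [← hY']
      exact htT j
    · rw [isSemipositiveZ_mixedRows_iff hX hY hproper huniv,
        ← isSemipositiveZ_mixedRows_iff hX hY hproper (α := Finset.univ.erase i)
          (fun h => Finset.notMem_erase i Finset.univ (h.symm ▸ Finset.mem_univ i))] at hα
      obtain ⟨hZ, t, ht, htT⟩ := hα
      exact ⟨Function.update t i 0, update_zero_nonneg ht i, fun j hj =>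
        vecMul_update_zero_pos hZ (fun k hk => by simp [mixedRows, hk]) ht htT
          (Finset.ne_of_mem_erase hj)⟩
  have hrow : (A⁻¹ i) ᵥ* (A * X) = X i := by
    have h : A⁻¹ * (A * X) = X :=
      Matrix.nonsing_inv_mul_cancel_left A X (isUnit_iff_ne_zero.mpr hdet.ne)
    funext j
    exact congrFun (congrFun h i) j
  intro j
  have hnonneg := hY.nonneg_of_vecMul (Finset.univ.erase i) (z := -A⁻¹ i) ht htY
    (fun k hk => by
      have : k = i := by simpa using hk
      simpa [this] using hdiag.le)
    (fun k hk => by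
      rw [Matrix.neg_vecMul, hrow]
      simpa using hX i k (Finset.ne_of_mem_erase hk).symm) j
  simpa using hnonneg
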